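/- arXiv:2406.12777 — 2 statements merged into one kernel-verified Lean document; each statement's English description precedes it below -/
import Mathlib

section
/- Let G be a finitely generated group and let X ⊆ A^G and Y ⊆ B^G be subshifts. (1) If there exists a morphism from X to Y (a continuous shift-equivariant map), then m(X) ≥ m(Y); in particular the Medvedev degree of a subshift does not increase under topological factor maps and is a topological conjugacy invariant. (2) m(X × Y) = m(X) ∨ m(Y), where X × Y ⊆ (A×B)^G is the product subshift {(x(g),y(g))_{g∈G} : x ∈ X, y ∈ Y}. (3) m(X ⊔ Y) = m(X) ∧ m(Y), where X ⊔ Y is the disjoint union subshift over the disjoint union of the alphabets A and B. -/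
namespace MedvedevFormal

/-! ### Medvedev reducibility on Baire space -/

/-- The finite prefix of length `k` of a point of Baire space, as a list. -/
def pref (x : ℕ → ℕ) (k : ℕ) : List ℕ := (List.range k).map x

/-- Medvedev reducibility `m(P) ≤ m(Q)` between subsets of Baire space: some computable
monotone prefix-functional (i.e. a partial computable type-two functional), defined on all
of `Q`, maps every element of `Q` to an element of `P`. -/
def BaireLE (P Q : Set (ℕ → ℕ)) : Prop :=
  ∃ φ : List ℕ → List ℕ, Computable φ ∧
    (∀ l₁ l₂ : List ℕ, l₁ <+: l₂ → φ l₁ <+: φ l₂) ∧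
    ∀ x ∈ Q, ∃ y ∈ P, ∀ n : ℕ, ∃ k : ℕ, (φ (pref x k))[n]? = some (y n)

/-- Medvedev equivalence: `m(P) = m(Q)`. -/
def BaireEquiv (P Q : Set (ℕ → ℕ)) : Prop := BaireLE P Q ∧ BaireLE Q P

/-- A canonical representative of the join `m(P) ∨ m(Q)`. -/
def joinSet (P Q : Set (ℕ → ℕ)) : Set (ℕ → ℕ) :=
  {x | (fun n => x (2 * n)) ∈ P ∧ (fun n => x (2 * n + 1)) ∈ Q}

/-- A canonical representative of the meet `m(P) ∧ m(Q)`. -/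
def meetSet (P Q : Set (ℕ → ℕ)) : Set (ℕ → ℕ) :=
  {x | (x 0 = 0 ∧ (fun n => x (n + 1)) ∈ P) ∨ (x 0 = 1 ∧ (fun n => x (n + 1)) ∈ Q)}

/-- `P` has the zero Medvedev degree `0_M`: it contains a computable point. -/
def IsZeroDeg (P : Set (ℕ → ℕ)) : Prop := ∃ y ∈ P, Computable y

/-- The cylinder of a finite word in Baire space. -/
def cylinder (l : List ℕ) : Set (ℕ → ℕ) :=
  {x | ∀ (i : ℕ) (h : i < l.length), x i = l[i]}

/-- Cantor space `{0,1}^ℕ` inside Baire space. -/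
def cantorSpace : Set (ℕ → ℕ) := {x | ∀ n, x n ≤ 1}

/-- `P` is an effectively closed (`Π⁰₁`) subset of Cantor space: its complement within
Cantor space is the union of the cylinders of a computably enumerable sequence of words. -/
def IsPi01Cantor (P : Set (ℕ → ℕ)) : Prop :=
  ∃ f : ℕ → List ℕ, Computable f ∧ P = cantorSpace \ ⋃ n, cylinder (f n)

/-- The Medvedev degree of `P` is a `Π⁰₁` Medvedev degree. -/
def IsPi01Deg (P : Set (ℕ → ℕ)) : Prop :=
  ∃ Q, IsPi01Cantor Q ∧ Q.Nonempty ∧ BaireEquiv P Q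

/-- `P` realizes the maximal `Π⁰₁` Medvedev degree (the degree of the class of complete
consistent extensions of Peano arithmetic): it is a nonempty `Π⁰₁` subset of Cantor space
to which every nonempty `Π⁰₁` subset of Cantor space is Medvedev reducible. -/
def IsMaxPi01 (P : Set (ℕ → ℕ)) : Prop :=
  IsPi01Cantor P ∧ P.Nonempty ∧ ∀ Q, IsPi01Cantor Q → Q.Nonempty → BaireLE Q P

/-! ### Encoding of configuration spaces -/

/-- The canonical encoding of a configuration `x : α → A` as a point of Baire space. -/
def confFun {α A : Type*} [Encodable α] [Encodable A] (x : α → A) : ℕ → ℕ :=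
  fun n => Encodable.encode ((Encodable.decode (α := α) n).map x)

/-- The image of a set of configurations in Baire space, used to measure its
Medvedev degree. -/
def mSet {α A : Type*} [Encodable α] [Encodable A] (X : Set (α → A)) : Set (ℕ → ℕ) :=
  confFun '' X

/-- A configuration is computable if its Baire-space encoding is computable. -/
def ComputablePoint {α A : Type*} [Encodable α] [Encodable A] (x : α → A) : Prop :=
  Computable (confFun x)

/-- `m(X) ≤ m(Y)` for sets of configurations. -/
def MedLE {α A β B : Type*} [Encodable α] [Encodable A] [Encodable β] [Encodable B]
    (X : Set (α → A)) (Y : Set (β → B)) : Prop :=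
  BaireLE (mSet X) (mSet Y)

/-- `m(X) = m(Y)` for sets of configurations. -/
def MedEquiv {α A β B : Type*} [Encodable α] [Encodable A] [Encodable β] [Encodable B]
    (X : Set (α → A)) (Y : Set (β → B)) : Prop :=
  MedLE X Y ∧ MedLE Y X

/-! ### Subshifts -/

/-- The left shift action: `(g • x) h = x (g⁻¹ h)`. -/
def shift {G A : Type*} [Group G] (g : G) (x : G → A) : G → A := fun h => x (g⁻¹ * h)

/-- The prodiscrete topology on `A^G`. -/
def prodiscrete (G A : Type*) : TopologicalSpace (G → A) :=
  @Pi.topologicalSpace G (fun _ => A) fun _ => ⊥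

/-- A subshift: a shift-invariant subset of `A^G`, closed in the prodiscrete topology. -/
def IsSubshift {G A : Type*} [Group G] (X : Set (G → A)) : Prop :=
  (∀ x ∈ X, ∀ g : G, shift g x ∈ X) ∧ @IsClosed (G → A) (prodiscrete G A) X

/-- A pattern: a map `p : D → A` with `D ⊆ G` finite. -/
structure Pattern (G A : Type*) where
  dom : Finset G
  val : {g // g ∈ dom} → A

/-- The translate `g • x` agrees with the pattern `p` on its domain. -/
def MatchesAt {G A : Type*} [Group G] (p : Pattern G A) (g : G) (x : G → A) : Prop :=
  ∀ h : {g' // g' ∈ p.dom}, shift g x h = p.val h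

/-- A subshift of finite type: defined by a finite list of forbidden patterns. -/
def IsSFT {G A : Type*} [Group G] (X : Set (G → A)) : Prop :=
  ∃ F : List (Pattern G A), X = {x | ∀ p ∈ F, ∀ g : G, ¬MatchesAt p g x}

/-- A morphism between subshifts: a continuous shift-equivariant map from `X` to `Y`. -/
def IsMorphism {G A B : Type*} [Group G] (X : Set (G → A)) (Y : Set (G → B))
    (φ : (G → A) → (G → B)) : Prop :=
  Set.MapsTo φ X Y ∧
    @ContinuousOn (G → A) (G → B) (prodiscrete G A) (prodiscrete G B) φ X ∧
    ∀ x ∈ X, ∀ g : G, φ (shift g x) = shift g (φ x)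

/-- A sofic subshift: the image of an SFT (on some finite alphabet) under a topological
factor map. -/
def IsSofic {G A : Type*} [Group G] (X : Set (G → A)) : Prop :=
  ∃ (B : Type) (_ : Finite B) (Y : Set (G → B)) (φ : (G → B) → (G → A)),
    IsSFT Y ∧ IsMorphism Y X φ ∧ φ '' Y = X

/-! ### Finitely generated groups, covers and pullbacks -/

/-- `σ` enumerates a finite symmetric generating set of `G`. -/
def IsSymmGen {G : Type*} [Group G] {k : ℕ} (σ : Fin k → G) : Prop :=
  Subgroup.closure (Set.range σ) = ⊤ ∧ ∀ i, (σ i)⁻¹ ∈ Set.range σ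

/-- The canonical encoding of a free group via reduced words. -/
instance freeGroupEncodable {α : Type*} [DecidableEq α] [Encodable α] :
    Encodable (FreeGroup α) :=
  Encodable.ofLeftInjection FreeGroup.toWord (fun l => some (FreeGroup.mk l))
    fun _ => congrArg some FreeGroup.mk_toWord

/-- The canonical homomorphism from the free group determined by `σ`. -/
def cover {G : Type*} [Group G] {k : ℕ} (σ : Fin k → G) : FreeGroup (Fin k) →* G :=
  FreeGroup.lift σ

/-- The pullback of a subshift along a group homomorphism. -/
def pullback {K G A : Type*} [Group K] [Group G] (ρ : K →* G) (X : Set (G → A)) :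
    Set (K → A) :=
  (fun x => x ∘ ρ) '' X

/-- The group element represented by a word over the generators. -/
def wordVal {G : Type*} [Group G] {k : ℕ} (σ : Fin k → G) (w : List (Fin k × Bool)) : G :=
  cover σ (FreeGroup.mk w)

/-- `G` is recursively presented w.r.t. `σ`: its word problem is recursively enumerable. -/
def RecursivelyPresented {G : Type*} [Group G] {k : ℕ} (σ : Fin k → G) : Prop :=
  ∃ f : ℕ → Option (List (Fin k × Bool)), Computable f ∧
    ∀ w : List (Fin k × Bool), (wordVal σ w = 1 ↔ ∃ n, f n = some w)

/-- The membership problem of the subgroup `H` in `G` is decidable w.r.t. `σ`. -/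
def DecidableMembership {G : Type*} [Group G] {k : ℕ} (σ : Fin k → G)
    (H : Subgroup G) : Prop :=
  ∃ φ : List (Fin k × Bool) → Bool, Computable φ ∧
    ∀ w : List (Fin k × Bool), (φ w = true ↔ wordVal σ w ∈ H)

/-- `G` has decidable word problem w.r.t. `σ`. -/
def DecidableWordProblem {G : Type*} [Group G] {k : ℕ} (σ : Fin k → G) : Prop :=
  ∃ φ : List (Fin k × Bool) → Bool, Computable φ ∧
    ∀ w : List (Fin k × Bool), (φ w = true ↔ wordVal σ w = 1)

/-- The set of configurations on the free group matching a coded pattern: a pattern is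
coded as a list of pairs (code of a group element, code of a letter). -/
def codedCylinder {k : ℕ} {A : Type*} [Encodable A] (p : List (ℕ × ℕ)) :
    Set (FreeGroup (Fin k) → A) :=
  {x | ∀ q ∈ p, ∀ g : FreeGroup (Fin k),
    Encodable.encode g = q.1 → Encodable.encode (x g) = q.2}

/-- `X` is an effective subshift: the complement of its pullback to the free group is the
union of the cylinders of a computably enumerable sequence of finitely supported patterns. -/
def IsEffective {G : Type*} [Group G] {k : ℕ} (σ : Fin k → G) {A : Type*} [Encodable A]
    (X : Set (G → A)) : Prop :=
  ∃ f : ℕ → List (ℕ × ℕ), Computable f ∧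
    (pullback (cover σ) X)ᶜ = ⋃ n, codedCylinder (f n)

/-! ### Degree spectra -/

/-- The Medvedev degree of `P` belongs to `M_SFT(G)`: some nonempty `G`-SFT has the
Medvedev degree of `P`. -/
def IsSFTDeg {G : Type*} [Group G] {k : ℕ} (σ : Fin k → G) (P : Set (ℕ → ℕ)) : Prop :=
  ∃ (n : ℕ) (X : Set (G → Fin n)), IsSFT X ∧ X.Nonempty ∧
    BaireEquiv (mSet (pullback (cover σ) X)) P

/-- The Medvedev degree of `P` belongs to `M_sof(G)`. -/
def IsSoficDeg {G : Type*} [Group G] {k : ℕ} (σ : Fin k → G) (P : Set (ℕ → ℕ)) : Prop :=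
  ∃ (n : ℕ) (X : Set (G → Fin n)), IsSofic X ∧ X.Nonempty ∧
    BaireEquiv (mSet (pullback (cover σ) X)) P

/-- The Medvedev degree of `P` belongs to `M_eff(G)`. -/
def IsEffDeg {G : Type*} [Group G] {k : ℕ} (σ : Fin k → G) (P : Set (ℕ → ℕ)) : Prop :=
  ∃ (n : ℕ) (X : Set (G → Fin n)), IsSubshift X ∧ IsEffective σ X ∧ X.Nonempty ∧
    BaireEquiv (mSet (pullback (cover σ) X)) P

/-! ### Word metrics and quasi-isometries -/

/-- The word length of `g` w.r.t. the (symmetric) generating map `σ`. -/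
noncomputable def wordNorm {G : Type*} [Group G] {k : ℕ} (σ : Fin k → G) (g : G) : ℕ :=
  sInf {n | ∃ w : List (Fin k), w.length = n ∧ (w.map σ).prod = g}

/-- The word metric on `G` w.r.t. `σ`, as a real number. -/
noncomputable def wordDist {G : Type*} [Group G] {k : ℕ} (σ : Fin k → G) (g g' : G) : ℝ :=
  (wordNorm σ (g⁻¹ * g') : ℝ)

/-- `f : G → H` is a quasi-isometry w.r.t. the word metrics given by `σ` and `τ`. -/
def IsQIGroups {G H : Type*} [Group G] [Group H] {k r : ℕ} (σ : Fin k → G)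
    (τ : Fin r → H) (f : G → H) : Prop :=
  ∃ C : ℝ, 1 ≤ C ∧
    (∀ g g' : G, (1 / C) * wordDist σ g g' - C ≤ wordDist τ (f g) (f g') ∧
      wordDist τ (f g) (f g') ≤ C * wordDist σ g g' + C) ∧
    ∀ h : H, ∃ g : G, wordDist τ h (f g) ≤ C

/-- `f : G → Y` is a quasi-isometry from the group `G` (with word metric from `σ`) to the
metric space `Y`. -/
def IsQIToSpace {G : Type*} [Group G] {k : ℕ} (σ : Fin k → G) {Y : Type*}
    [MetricSpace Y] (f : G → Y) : Prop :=
  ∃ C : ℝ, 1 ≤ C ∧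
    (∀ g g' : G, (1 / C) * wordDist σ g g' - C ≤ dist (f g) (f g') ∧
      dist (f g) (f g') ≤ C * wordDist σ g g' + C) ∧
    ∀ y : Y, ∃ g : G, dist y (f g) ≤ C

/-- `f : G → H` is computable w.r.t. the generating maps `σ` and `τ`: some computable map
on words sends each word representing `g` to a word representing `f g`. -/
def ComputableMap {G H : Type*} [Group G] [Group H] {k r : ℕ} (σ : Fin k → G)
    (τ : Fin r → H) (f : G → H) : Prop :=
  ∃ φ : List (Fin k × Bool) → List (Fin r × Bool), Computable φ ∧
    ∀ w : List (Fin k × Bool), wordVal τ (φ w) = f (wordVal σ w)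

/-- The direct product of two subshifts over the same group. -/
def prodShift {G A B : Type*} (X : Set (G → A)) (Y : Set (G → B)) : Set (G → A × B) :=
  {z | (fun g => (z g).1) ∈ X ∧ (fun g => (z g).2) ∈ Y}

/-- The disjoint union of two subshifts, over the disjoint union of the alphabets. -/
def sumShift {G A B : Type*} (X : Set (G → A)) (Y : Set (G → B)) : Set (G → A ⊕ B) :=
  (fun x => Sum.inl ∘ x) '' X ∪ (fun y => Sum.inr ∘ y) '' Y

/-- Running a partial stagewise computation `f` on `l` for `j` steps. -/
def stages (f : ℕ → List ℕ → Option ℕ) (l : List ℕ) : ℕ → List ℕ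
  | 0 => []
  | j + 1 => stages f l j ++ (f (stages f l j).length l).toList

theorem stages_getElem? (f : ℕ → List ℕ → Option ℕ) (l : List ℕ) (j i : ℕ)
    (hi : i < (stages f l j).length) : (stages f l j)[i]? = f i l := by
  induction j with
  | zero => simp [stages] at hi
  | succ j ih =>
    simp only [stages] at hi ⊢
    rcases lt_or_ge i (stages f l j).length with h | h
    · rw [List.getElem?_append_left h, ih h]
    · rw [List.getElem?_append_right h]
      rcases hv : f (stages f l j).length l with _ | v
      · simp [hv] at hi; omega
      · simp [hv] at hi
        obtain rfl : i = (stages f l j).length := by omega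
        simp [hv]

theorem stages_prefix_of_le (f : ℕ → List ℕ → Option ℕ) (l : List ℕ) {j j' : ℕ} (h : j ≤ j') :
    stages f l j <+: stages f l j' := by
  induction h with
  | refl => exact List.prefix_refl _
  | step _ ih => exact ih.trans (List.prefix_append _ _)

theorem stages_prefix_of_prefix {f : ℕ → List ℕ → Option ℕ}
    (hf : ∀ n l l' v, l <+: l' → f n l = some v → f n l' = some v)
    {l l' : List ℕ} (h : l <+: l') (j : ℕ) : stages f l j <+: stages f l' j := by
  induction j with
  | zero => exact List.prefix_refl _
  | succ j ih =>
    simp only [stages]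
    rcases hv : f (stages f l j).length l with _ | v
    · simpa using ih.trans (List.prefix_append _ _)
    · have hv' := hf _ _ _ _ h hv
      rcases ih.length_le.lt_or_eq with hlt | heq
      · refine List.IsPrefix.trans ?_ (List.prefix_append _ _)
        obtain ⟨t, ht⟩ := ih
        have h1 := stages_getElem? f l' j _ hlt
        rw [hv', ← ht] at h1
        rw [← ht]
        rcases t with _ | ⟨a, t⟩
        · simp at h1
        · simp at h1
          subst h1
          simp
      · have := ih.eq_of_length heq
        rw [← this, hv']

theorem length_stages {f : ℕ → List ℕ → Option ℕ} {l : List ℕ} {N : ℕ}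
    (hf : ∀ n < N, (f n l).isSome) : ∀ j ≤ N, (stages f l j).length = j := by
  intro j
  induction j with
  | zero => simp [stages]
  | succ j ih =>
    intro hj
    have h := ih (by omega)
    obtain ⟨v, hv⟩ := Option.isSome_iff_exists.1 (hf j (by omega))
    simp [stages, h, hv]

theorem primrec_stages {f : ℕ → List ℕ → Option ℕ} (hf : Primrec₂ f) :
    Primrec fun l => stages f l l.length := by
  have hl : Primrec fun o : Option ℕ => o.toList :=
    (Primrec.option_casesOn (o := fun o : Option ℕ => o) (f := fun _ => ([] : List ℕ))
      (g := fun _ v => [v]) Primrec.id (Primrec.const [])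
      (Primrec.list_cons.comp Primrec.snd (Primrec.const []))).of_eq (by rintro (_ | _) <;> rfl)
  have h : Primrec₂ fun (l : List ℕ) (p : ℕ × List ℕ) => p.2 ++ (f p.2.length l).toList :=
    Primrec.list_append.comp (Primrec.snd.comp Primrec.snd)
      (hl.comp (hf.comp (Primrec.list_length.comp (Primrec.snd.comp Primrec.snd)) Primrec.fst))
  refine (Primrec.nat_rec' Primrec.list_length (Primrec.const []) h).of_eq fun l => ?_
  generalize l.length = j
  induction j with
  | zero => rfl
  | succ j ih => simp only [stages, ← ih]

theorem pref_getElem? (x : ℕ → ℕ) (k i : ℕ) :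
    (pref x k)[i]? = if i < k then some (x i) else none := by
  by_cases h : i < k <;> simp [pref, h]

theorem pref_prefix (x : ℕ → ℕ) {k k' : ℕ} (h : k ≤ k') : pref x k <+: pref x k' := by
  have : List.range k <+: List.range k' := by
    obtain ⟨d, rfl⟩ := Nat.exists_eq_add_of_le h
    rw [List.range_add]
    exact List.prefix_append _ _
  exact this.map x

theorem BaireLE.of_stagewise {P Q : Set (ℕ → ℕ)} {f : ℕ → List ℕ → Option ℕ} (hf : Primrec₂ f)
    (hmono : ∀ n l l' v, l <+: l' → f n l = some v → f n l' = some v)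
    (h : ∀ x ∈ Q, ∃ y ∈ P, ∀ n, ∃ k, f n (pref x k) = some (y n)) : BaireLE P Q := by
  refine ⟨fun l => stages f l l.length, (primrec_stages hf).to_comp, fun l l' hl =>
    (stages_prefix_of_prefix hmono hl _).trans (stages_prefix_of_le _ _ hl.length_le), ?_⟩
  intro x hx
  obtain ⟨y, hy, hxy⟩ := h x hx
  refine ⟨y, hy, fun n => ?_⟩
  choose k hk using hxy
  set K := (Finset.range (n + 1)).sup k + (n + 1) with hK
  have hsome : ∀ m < n + 1, f m (pref x K) = some (y m) := fun m hm =>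
    hmono _ _ _ _ (pref_prefix x
      ((Finset.le_sup (f := k) (Finset.mem_range.2 hm)).trans (Nat.le_add_right _ _))) (hk m)
  refine ⟨K, ?_⟩
  have hlen : (pref x K).length = K := by simp [pref]
  have h1 := length_stages (f := f) (l := pref x K) (fun m hm => by rw [hsome m hm]; rfl) (n + 1) le_rfl
  have h2 := (stages_prefix_of_le f (pref x K) (show n + 1 ≤ K by omega)).length_le
  change (stages f (pref x K) (pref x K).length)[n]? = _
  rw [hlen, stages_getElem? _ _ _ _ (by omega), hsome n (by omega)]

/-- A reduction whose `n`-th output is computed from finitely many computable queries. -/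
theorem BaireLE.of_queries {P Q : Set (ℕ → ℕ)} {q : ℕ → List ℕ} {h : ℕ → List ℕ → ℕ}
    (hq : Primrec q) (hh : Primrec₂ h)
    (H : ∀ x ∈ Q, (fun n => h n ((q n).map x)) ∈ P) : BaireLE P Q := by
  refine BaireLE.of_stagewise
    (f := fun n l => if ∀ i ∈ q n, i < l.length then
      some (h n ((q n).map fun i => l.getD i 0)) else none) ?_ ?_ ?_
  · refine Primrec.ite ?_ ?_ (Primrec.const none)
    · exact (PrimrecRel.forall_mem_list (R := fun i m : ℕ => i < m) Primrec.nat_lt).comp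
        (hq.comp Primrec.fst) (Primrec.list_length.comp Primrec.snd)
    · refine Primrec.option_some.comp (hh.comp Primrec.fst
        (Primrec.list_map (hq.comp Primrec.fst) ?_))
      exact (Primrec.list_getD 0).comp (Primrec.snd.comp Primrec.fst) Primrec.snd
  · intro n l l' v hl hv
    rw [Option.ite_none_right_eq_some] at hv ⊢
    obtain ⟨hlt, hv⟩ := hv
    refine ⟨fun i hi => (hlt i hi).trans_le hl.length_le, ?_⟩
    rw [← hv]
    congr 2
    refine List.map_congr_left fun i hi => ?_
    obtain ⟨t, rfl⟩ := hl
    rw [List.getD_append _ _ _ _ (hlt i hi)]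
  · intro x hx
    refine ⟨_, H x hx, fun n => ⟨(q n).sum + 1, ?_⟩⟩
    have hlt : ∀ i ∈ q n, i < (q n).sum + 1 := fun i hi =>
      Nat.lt_succ_of_le (List.single_le_sum (by simp) i hi)
    rw [if_pos (by simpa [pref] using hlt)]
    congr 2
    refine List.map_congr_left fun i hi => ?_
    rw [List.getD_eq_getElem?_getD, pref_getElem?, if_pos (hlt i hi)]
    rfl

theorem confFun_eq {α A : Type*} [Encodable α] [Encodable A] (x : α → A) (n : ℕ) :
    confFun x n = ((Encodable.decode (α := α) n).map fun g => Encodable.encode (x g) + 1).getD 0 := by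
  unfold confFun
  rcases Encodable.decode (α := α) n with _ | a <;> simp

theorem exists_primrec_eqOn {α : Type*} [Primcodable α] [DecidableEq α] (f : α → ℕ) {S : Set α}
    (hS : S.Finite) : ∃ g : α → ℕ, Primrec g ∧ Set.EqOn g f S := by
  induction S, hS using Set.Finite.induction_on with
  | empty => exact ⟨fun _ => 0, Primrec.const 0, Set.eqOn_empty _ _⟩
  | @insert a S _ _ ih =>
    obtain ⟨g, hg, hgf⟩ := ih
    refine ⟨fun b => if b = a then f a else g b,
      Primrec.ite (Primrec.eq.comp Primrec.id (Primrec.const a)) (Primrec.const _) hg, ?_⟩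
    rintro b (rfl | hb)
    · simp
    · by_cases hba : b = a <;> simp [hba, hgf hb]

theorem decode_freeGroup {k : ℕ} (n : ℕ) : (Encodable.decode n : Option (FreeGroup (Fin k))) =
    (Encodable.decode n : Option (List (Fin k × Bool))).map FreeGroup.mk := by
  change Option.bind _ _ = _
  rcases (Encodable.decode n : Option (List (Fin k × Bool))) with _ | l <;> rfl

theorem confFun_encode {k : ℕ} {A : Type*} [Encodable A] (x : FreeGroup (Fin k) → A)
    (l : List (Fin k × Bool)) :
    confFun x (Encodable.encode l) = Encodable.encode (x (FreeGroup.mk l)) + 1 := by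
  simp [confFun_eq, decode_freeGroup]

section Product

variable {α A B : Type*} [Encodable α] [Encodable A] [Encodable B]

theorem confFun_fst (z : α → A × B) (n : ℕ) : confFun (fun g => (z g).1) n =
    if confFun z n = 0 then 0 else (confFun z n - 1).unpair.1 + 1 := by
  rcases h : Encodable.decode (α := α) n with _ | a
  · simp [confFun_eq, h]
  · rcases hz : z a with ⟨b, c⟩
    simp [confFun_eq, h, hz]

theorem confFun_snd (z : α → A × B) (n : ℕ) : confFun (fun g => (z g).2) n =
    if confFun z n = 0 then 0 else (confFun z n - 1).unpair.2 + 1 := by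
  rcases h : Encodable.decode (α := α) n with _ | a
  · simp [confFun_eq, h]
  · rcases hz : z a with ⟨b, c⟩
    simp [confFun_eq, h, hz]

theorem confFun_prodMk (x : α → A) (y : α → B) (n : ℕ) : confFun (fun g => (x g, y g)) n =
    if confFun x n = 0 then 0 else Nat.pair (confFun x n - 1) (confFun y n - 1) + 1 := by
  rcases h : Encodable.decode (α := α) n with _ | a <;> simp [confFun_eq, h]

theorem baireEquiv_prodShift (X : Set (α → A)) (Y : Set (α → B)) :
    BaireEquiv (mSet (prodShift X Y)) (joinSet (mSet X) (mSet Y)) := by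
  constructor
  · refine BaireLE.of_queries (q := fun n => [2 * n, 2 * n + 1]) (h := fun _ vs =>
      if vs.getD 0 0 = 0 then 0 else Nat.pair (vs.getD 0 0 - 1) (vs.getD 1 0 - 1) + 1) ?_ ?_ ?_
    · exact Primrec.list_cons.comp Primrec.nat_double
        (Primrec.list_cons.comp Primrec.nat_double_succ (Primrec.const []))
    · have hv (i : ℕ) : Primrec fun p : ℕ × List ℕ => p.2.getD i 0 :=
        (Primrec.list_getD 0).comp Primrec.snd (Primrec.const i)
      exact Primrec.ite (Primrec.eq.comp (hv 0) (Primrec.const 0)) (Primrec.const 0)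
        (Primrec.succ.comp (Primrec₂.natPair.comp (Primrec.pred.comp (hv 0))
          (Primrec.pred.comp (hv 1))))
    · rintro u ⟨⟨x, hx, hxu⟩, ⟨y, hy, hyu⟩⟩
      refine ⟨fun g => (x g, y g), ⟨hx, hy⟩, ?_⟩
      funext n
      have h0 := congrFun hxu n
      have h1 := congrFun hyu n
      simp [confFun_prodMk, h0, h1]
  · refine BaireLE.of_queries (q := fun n => [n / 2]) (h := fun n vs =>
      if vs.getD 0 0 = 0 then 0 else
        if n % 2 = 0 then (vs.getD 0 0 - 1).unpair.1 + 1 else (vs.getD 0 0 - 1).unpair.2 + 1)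
      ?_ ?_ ?_
    · exact Primrec.list_cons.comp (Primrec.nat_div.comp Primrec.id (Primrec.const 2))
        (Primrec.const [])
    · have hv : Primrec fun p : ℕ × List ℕ => p.2.getD 0 0 :=
        (Primrec.list_getD 0).comp Primrec.snd (Primrec.const 0)
      have hu := Primrec.unpair.comp (Primrec.pred.comp hv)
      exact Primrec.ite (Primrec.eq.comp hv (Primrec.const 0)) (Primrec.const 0)
        (Primrec.ite (Primrec.eq.comp (Primrec.nat_mod.comp Primrec.fst (Primrec.const 2))
          (Primrec.const 0)) (Primrec.succ.comp (Primrec.fst.comp hu))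
          (Primrec.succ.comp (Primrec.snd.comp hu)))
    · rintro _ ⟨z, ⟨hx, hy⟩, rfl⟩
      refine ⟨⟨_, hx, ?_⟩, ⟨_, hy, ?_⟩⟩
      · funext n
        simp [confFun_fst]
      · funext n
        have h2 : (2 * n + 1) / 2 = n := by omega
        have h3 : (2 * n + 1) % 2 = 1 := by omega
        simp [confFun_snd, h2, h3]

end Product

section Sum

variable {α A B : Type*} [Encodable α] [Encodable A] [Encodable B]

theorem confFun_inl (x : α → A) (n : ℕ) : confFun (Sum.inl ∘ x : α → A ⊕ B) n =
    if confFun x n = 0 then 0 else 2 * (confFun x n - 1) + 1 := by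
  rcases h : Encodable.decode (α := α) n with _ | a <;> simp [confFun_eq, h]

theorem confFun_inr (y : α → B) (n : ℕ) : confFun (Sum.inr ∘ y : α → A ⊕ B) n =
    if confFun y n = 0 then 0 else 2 * (confFun y n - 1) + 2 := by
  rcases h : Encodable.decode (α := α) n with _ | a <;> simp [confFun_eq, h]

theorem baireEquiv_sumShift (h0 : (Encodable.decode (α := α) 0).isSome)
    (X : Set (α → A)) (Y : Set (α → B)) :
    BaireEquiv (mSet (sumShift X Y)) (meetSet (mSet X) (mSet Y)) := by
  constructor
  · refine BaireLE.of_queries (q := fun n => [0, n + 1]) (h := fun _ vs =>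
      if vs.getD 1 0 = 0 then 0 else 2 * (vs.getD 1 0 - 1) + (vs.getD 0 0 + 1)) ?_ ?_ ?_
    · exact Primrec.list_cons.comp (Primrec.const 0)
        (Primrec.list_cons.comp Primrec.succ (Primrec.const []))
    · have hv (i : ℕ) : Primrec fun p : ℕ × List ℕ => p.2.getD i 0 :=
        (Primrec.list_getD 0).comp Primrec.snd (Primrec.const i)
      exact Primrec.ite (Primrec.eq.comp (hv 1) (Primrec.const 0)) (Primrec.const 0)
        (Primrec.nat_add.comp (Primrec.nat_double.comp (Primrec.pred.comp (hv 1)))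
          (Primrec.succ.comp (hv 0)))
    · rintro u (⟨hu, ⟨x, hx, hxu⟩⟩ | ⟨hu, ⟨y, hy, hyu⟩⟩)
      · refine ⟨Sum.inl ∘ x, Or.inl ⟨x, hx, rfl⟩, ?_⟩
        funext n
        have h := congrFun hxu n
        simp [confFun_inl, h, hu]
      · refine ⟨Sum.inr ∘ y, Or.inr ⟨y, hy, rfl⟩, ?_⟩
        funext n
        have h := congrFun hyu n
        simp [confFun_inr, h, hu]
  · refine BaireLE.of_queries (q := fun n => [0, n - 1]) (h := fun n vs =>
      if n = 0 then (vs.getD 0 0 - 1) % 2 else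
        if vs.getD 1 0 = 0 then 0 else (vs.getD 1 0 - 1) / 2 + 1) ?_ ?_ ?_
    · exact Primrec.list_cons.comp (Primrec.const 0)
        (Primrec.list_cons.comp Primrec.pred (Primrec.const []))
    · have hv (i : ℕ) : Primrec fun p : ℕ × List ℕ => p.2.getD i 0 :=
        (Primrec.list_getD 0).comp Primrec.snd (Primrec.const i)
      exact Primrec.ite (Primrec.eq.comp Primrec.fst (Primrec.const 0))
        (Primrec.nat_mod.comp (Primrec.pred.comp (hv 0)) (Primrec.const 2))
        (Primrec.ite (Primrec.eq.comp (hv 1) (Primrec.const 0)) (Primrec.const 0)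
          (Primrec.succ.comp (Primrec.nat_div.comp (Primrec.pred.comp (hv 1))
            (Primrec.const 2))))
    · obtain ⟨a, ha⟩ := Option.isSome_iff_exists.1 h0
      rintro _ ⟨_, (⟨x, hx, rfl⟩ | ⟨y, hy, rfl⟩), rfl⟩
      · refine Or.inl ⟨?_, x, hx, ?_⟩
        · simp [confFun_eq, ha]
        · funext n
          by_cases hn : confFun x n = 0
          · simp [confFun_inl, hn]
          · simp [confFun_inl, hn]
            omega
      · refine Or.inr ⟨?_, y, hy, ?_⟩
        · simp [confFun_eq, ha]
        · funext n
          by_cases hn : confFun y n = 0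
          · simp [confFun_inr, hn]
          · simp [confFun_inr, hn]
            omega

end Sum

theorem pullback_prodShift {K G A B : Type*} [Group K] [Group G] (ρ : K →* G)
    (X : Set (G → A)) (Y : Set (G → B)) :
    pullback ρ (prodShift X Y) = prodShift (pullback ρ X) (pullback ρ Y) := by
  ext z
  constructor
  · rintro ⟨w, ⟨hx, hy⟩, rfl⟩
    exact ⟨⟨_, hx, rfl⟩, ⟨_, hy, rfl⟩⟩
  · rintro ⟨⟨x, hx, hxz⟩, ⟨y, hy, hyz⟩⟩
    exact ⟨fun g => (x g, y g), ⟨hx, hy⟩,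
      funext fun u => Prod.ext (congrFun hxz u) (congrFun hyz u)⟩

theorem pullback_sumShift {K G A B : Type*} [Group K] [Group G] (ρ : K →* G)
    (X : Set (G → A)) (Y : Set (G → B)) :
    pullback ρ (sumShift X Y) = sumShift (pullback ρ X) (pullback ρ Y) := by
  simp only [pullback, sumShift, Set.image_union, Set.image_image]
  rfl

theorem cover_surjective {G : Type*} [Group G] {k : ℕ} {σ : Fin k → G} (hσ : IsSymmGen σ) :
    Function.Surjective (cover σ) := by
  rw [← MonoidHom.range_eq_top, cover, FreeGroup.range_lift_eq_closure, hσ.1]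

/-- A continuous map on a closed set of configurations over a finite alphabet has a finite
window determining the value of its image at the identity. -/
theorem exists_finite_window {G A B : Type*} [Group G] [Finite A] {X : Set (G → A)}
    (hX : @IsClosed (G → A) (prodiscrete G A) X) {φ : (G → A) → (G → B)}
    (hφ : @ContinuousOn (G → A) (G → B) (prodiscrete G A) (prodiscrete G B) φ X) :
    ∃ D : Finset G, ∀ x ∈ X, ∀ x' ∈ X, (∀ d ∈ D, x d = x' d) → φ x 1 = φ x' 1 := by
  let _ : TopologicalSpace A := ⊥
  let _ : TopologicalSpace B := ⊥
  have _ : DiscreteTopology A := ⟨rfl⟩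
  have _ : DiscreteTopology B := ⟨rfl⟩
  replace hX : IsClosed X := hX
  replace hφ : ContinuousOn φ X := hφ
  classical
  have key : ∀ x ∈ X, ∃ D : Finset G,
      ∀ x' ∈ X, (∀ d ∈ D, x' d = x d) → φ x' 1 = φ x 1 := by
    intro x hx
    have h1 : ContinuousWithinAt (fun z => φ z 1) X x :=
      (continuous_apply (1 : G)).continuousAt.comp_continuousWithinAt (hφ x hx)
    have h2 : {z | φ z 1 = φ x 1} ∈ nhdsWithin x X :=
      h1 ((isOpen_discrete {φ x 1}).mem_nhds rfl)
    obtain ⟨U, hU, hxU, hUX⟩ := mem_nhdsWithin.1 h2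
    obtain ⟨D, u, hu, hD⟩ := isOpen_pi_iff.1 hU x hxU
    refine ⟨D, fun x' hx' h => hUX ⟨hD fun d hd => ?_, hx'⟩⟩
    rw [h d hd]
    exact (hu d hd).2
  choose! D hD using key
  have hopen (x : G → A) : IsOpen {z : G → A | ∀ d ∈ D x, z d = x d} := by
    have h := isOpen_set_pi (D x).finite_toSet
      (fun d (_ : d ∈ (D x : Set G)) => isOpen_discrete ({x d} : Set A))
    convert h using 1
    ext z
    simp
  obtain ⟨t, htX, ht⟩ := hX.isCompact.elim_nhds_subcover (fun x => {z | ∀ d ∈ D x, z d = x d})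
    fun x _ => (hopen x).mem_nhds fun _ _ => rfl
  refine ⟨t.biUnion D, fun x hx x' hx' h => ?_⟩
  obtain ⟨c, hc, hxc⟩ := Set.mem_iUnion₂.1 (ht hx)
  have hx'c : ∀ d ∈ D c, x' d = c d := fun d hd => by
    rw [← h d (Finset.mem_biUnion.2 ⟨c, hc, hd⟩), hxc d hd]
  rw [hD c (htX c hc) x hx hxc, hD c (htX c hc) x' hx' hx'c]

/-- A continuous map on a subshift is given at the identity by a primitive recursive local
rule acting on the codes of the letters in a finite window. -/
theorem exists_primrec_local_rule {G A B : Type*} [Group G] [Finite A] [Encodable A] [Encodable B]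
    {X : Set (G → A)} (hX : @IsClosed (G → A) (prodiscrete G A) X) {φ : (G → A) → (G → B)}
    (hφ : @ContinuousOn (G → A) (G → B) (prodiscrete G A) (prodiscrete G B) φ X) :
    ∃ (D : List G) (μ : List ℕ → ℕ), Primrec μ ∧ ∀ x ∈ X,
      μ (D.map fun d => Encodable.encode (x d) + 1) = Encodable.encode (φ x 1) + 1 := by
  obtain ⟨D, hD⟩ := exists_finite_window hX hφ
  let win : X → List ℕ := fun x => D.toList.map fun d => Encodable.encode (x.1 d) + 1
  have hfac : Function.FactorsThrough (fun x : X => Encodable.encode (φ x 1) + 1) win := by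
    intro x x' h
    simp only [win, List.map_inj_left, Finset.mem_toList, Nat.add_right_cancel_iff,
      Encodable.encode_inj] at h
    simp only [hD x x.2 x' x'.2 h]
  have hfin : (Set.range win).Finite := by
    refine ((List.finite_length_eq A D.toList.length).image
      (List.map fun a => Encodable.encode a + 1)).subset ?_
    rintro _ ⟨x, rfl⟩
    exact ⟨D.toList.map x.1, by simp, by simp [win]⟩
  obtain ⟨μ, hμ, hμeq⟩ := exists_primrec_eqOn
    (Function.extend win (fun x : X => Encodable.encode (φ x 1) + 1) 0) hfin
  refine ⟨D.toList, μ, hμ, fun x hx => ?_⟩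
  have h := hμeq ⟨⟨x, hx⟩, rfl⟩
  rw [hfac.extend_apply] at h
  exact h

theorem IsMorphism.medLE {G A B : Type*} [Group G] [Finite A] [Encodable A] [Encodable B]
    {k : ℕ} {σ : Fin k → G} (hσ : IsSymmGen σ) {X : Set (G → A)} (hX : IsSubshift X)
    {Y : Set (G → B)} {φ : (G → A) → (G → B)} (hφ : IsMorphism X Y φ) :
    MedLE (pullback (cover σ) Y) (pullback (cover σ) X) := by
  obtain ⟨hmaps, hcont, heq⟩ := hφ
  obtain ⟨D, μ, hμ, hrule⟩ := exists_primrec_local_rule hX.2 hcont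
  have hword (g : G) : ∃ w : List (Fin k × Bool), wordVal σ w = g := by
    obtain ⟨u, rfl⟩ := cover_surjective hσ g
    exact ⟨u.toWord, by rw [wordVal, FreeGroup.mk_toWord]⟩
  choose w hw using hword
  refine BaireLE.of_queries
    (q := fun n => n :: D.map fun d => Encodable.encode
      (((Encodable.decode n : Option (List (Fin k × Bool))).getD []) ++ w d))
    (h := fun _ vs => if vs.getD 0 0 = 0 then 0 else μ vs.tail) ?_ ?_ ?_
  · refine Primrec.list_cons.comp Primrec.id ?_
    have h1 : Primrec fun n : ℕ =>
        (Encodable.decode n : Option (List (Fin k × Bool))).getD [] :=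
      Primrec.option_getD.comp Primrec.decode (Primrec.const [])
    have h2 : Primrec₂ fun (n : ℕ) (v : List (Fin k × Bool)) => Encodable.encode
        (((Encodable.decode n : Option (List (Fin k × Bool))).getD []) ++ v) :=
      Primrec.encode.comp (Primrec.list_append.comp (h1.comp Primrec.fst) Primrec.snd)
    refine (Primrec.list_map (Primrec.const (D.map w)) h2).of_eq fun n => ?_
    rw [List.map_map]
    rfl
  · exact Primrec.ite (Primrec.eq.comp ((Primrec.list_getD 0).comp Primrec.snd (Primrec.const 0))
      (Primrec.const 0)) (Primrec.const 0) (hμ.comp (Primrec.list_tail.comp Primrec.snd))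
  · rintro _ ⟨_, ⟨x, hx, rfl⟩, rfl⟩
    refine ⟨φ x ∘ cover σ, ⟨φ x, hmaps hx, rfl⟩, ?_⟩
    funext n
    rcases hn : (Encodable.decode n : Option (List (Fin k × Bool))) with _ | l
    · simp [confFun_eq, decode_freeGroup, hn]
    · have hsh := hrule _ (hX.1 x hx (wordVal σ l)⁻¹)
      rw [heq x hx] at hsh
      simp only [shift, inv_inv, mul_one] at hsh
      have hval : confFun (x ∘ cover σ) n ≠ 0 := by simp [confFun_eq, decode_freeGroup, hn]
      have hout : confFun (φ x ∘ cover σ) n = Encodable.encode (φ x (wordVal σ l)) + 1 := by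
        simp [confFun_eq, decode_freeGroup, hn, wordVal]
      simp only [List.map_cons, List.getD_cons_zero, hval, if_false, List.tail_cons,
        List.map_map, hout, Option.getD_some, ← hsh]
      congr 1
      refine List.map_congr_left fun d _ => ?_
      simp only [Function.comp_apply, confFun_encode]
      have hmul : cover σ (FreeGroup.mk (l ++ w d)) = wordVal σ l * d := by
        rw [← FreeGroup.mul_mk, map_mul]
        exact congrArg _ (hw d)
      rw [hmul]

/-- Basic properties of the Medvedev degree of subshifts: it does not increase under
morphisms (in particular it is a conjugacy invariant), the degree of a product is the
join of the degrees, and the degree of a disjoint union is the meet of the degrees. -/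
theorem statement0 {G : Type*} [Group G] {A B : Type*} [Finite A] [Encodable A]
    [Finite B] [Encodable B] {k : ℕ} (σ : Fin k → G) (hσ : IsSymmGen σ)
    (X : Set (G → A)) (hX : IsSubshift X) (Y : Set (G → B)) (hY : IsSubshift Y) :
    ((∃ φ : (G → A) → (G → B), IsMorphism X Y φ) →
      MedLE (pullback (cover σ) Y) (pullback (cover σ) X)) ∧
    BaireEquiv (mSet (pullback (cover σ) (prodShift X Y)))
      (joinSet (mSet (pullback (cover σ) X)) (mSet (pullback (cover σ) Y))) ∧
    BaireEquiv (mSet (pullback (cover σ) (sumShift X Y)))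
      (meetSet (mSet (pullback (cover σ) X)) (mSet (pullback (cover σ) Y))) := by
  refine ⟨fun ⟨_, hφ⟩ => hφ.medLE hσ hX, ?_, ?_⟩
  · rw [pullback_prodShift]
    exact baireEquiv_prodShift _ _
  · rw [pullback_sumShift]
    refine baireEquiv_sumShift ?_ _ _
    rw [decode_freeGroup, show (0 : ℕ) = Encodable.encode ([] : List (Fin k × Bool)) from rfl,
      Encodable.encodek]
    rfl

end MedvedevFormal
end

section
/- Let H ≤ G be finitely generated groups and let X ⊆ A^H be a subshift. Let X̃ ⊆ A^G be the free extension of X to G, namely X̃ = {x ∈ A^G : for every g ∈ G, the configuration h ↦ x(gh) (h ∈ H) belongs to X}. Then m(X) ≤ m(X̃). Furthermore, if either (1) G is recursively presented and the membership problem of H in G is decidable, or (2) H has finite index in G, then m(X) = m(X̃). -/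
namespace MedvedevFormal

/-- The free extension of a subshift `X ⊆ A^H` to the bigger group `G`. -/
def freeExt {G : Type*} [Group G] (H : Subgroup G) {A : Type*} (X : Set (↥H → A)) :
    Set (G → A) :=
  {x | ∀ g : G, (fun h : ↥H => x (g * h)) ∈ X}

section Reductions

/-- The value at `n` of the functional that queries its oracle at `g n`, as far as the finite
oracle prefix `l` determines it. -/
def queryVal (g : ℕ → Option ℕ) (l : List ℕ) (n : ℕ) : Option ℕ :=
  (g n).elim (some 0) fun i => l[i]?

/-- The first `m` outputs of the query functional of `g` on the oracle prefix `l`, truncated at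
the first undetermined value. -/
def queryList (g : ℕ → Option ℕ) (l : List ℕ) : ℕ → List ℕ
  | 0 => []
  | m + 1 => (queryVal g l (queryList g l m).length).elim (queryList g l m)
      fun v => queryList g l m ++ [v]

theorem queryVal_mono {g : ℕ → Option ℕ} {l₁ l₂ : List ℕ} (h : l₁ <+: l₂) {n v : ℕ}
    (hv : queryVal g l₁ n = some v) : queryVal g l₂ n = some v := by
  unfold queryVal at *
  cases hg : g n with
  | none => simpa [hg] using hv
  | some i =>
    simp only [hg, Option.elim_some] at hv ⊢
    obtain ⟨t, rfl⟩ := h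
    rw [List.getElem?_append_left (List.getElem?_eq_some_iff.1 hv).1, hv]

theorem queryList_getElem? (g : ℕ → Option ℕ) (l : List ℕ) (m i v : ℕ)
    (h : (queryList g l m)[i]? = some v) : queryVal g l i = some v := by
  induction m with
  | zero => simp [queryList] at h
  | succ m ih =>
    rw [queryList] at h
    cases hv : queryVal g l (queryList g l m).length with
    | none => exact ih (by simpa [hv] using h)
    | some u =>
      simp only [hv, Option.elim_some, List.getElem?_append] at h
      split_ifs at h with hi
      · exact ih h
      · have hlt := (List.getElem?_eq_some_iff.1 h).1
        simp only [List.length_singleton] at hlt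
        have : i = (queryList g l m).length := by omega
        subst this
        simpa [hv] using h

theorem le_length_queryList {g : ℕ → Option ℕ} {l : List ℕ} {m n : ℕ} (hnm : n ≤ m)
    (h : ∀ i < n, (queryVal g l i).isSome) : n ≤ (queryList g l m).length := by
  induction m generalizing n with
  | zero => omega
  | succ m ih =>
    rw [queryList]
    cases hv : queryVal g l (queryList g l m).length with
    | none =>
      simp only [Option.elim_none]
      by_contra! hlt
      have := h _ hlt
      simp [hv] at this
    | some u =>
      simp only [Option.elim_some, List.length_append, List.length_singleton]
      cases n with
      | zero => omega
      | succ n =>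
        have := ih (n := n) (by omega) fun i hi => h i (by omega)
        omega

theorem length_queryList_le (g : ℕ → Option ℕ) (l : List ℕ) (m : ℕ) :
    (queryList g l m).length ≤ m := by
  induction m with
  | zero => simp [queryList]
  | succ m ih =>
    rw [queryList]
    cases queryVal g l (queryList g l m).length <;> simp <;> omega

theorem queryList_prefix {g : ℕ → Option ℕ} {l₁ l₂ : List ℕ} (h : l₁ <+: l₂) :
    queryList g l₁ l₁.length <+: queryList g l₂ l₂.length := by
  have hval : ∀ i v, (queryList g l₁ l₁.length)[i]? = some v → queryVal g l₂ i = some v :=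
    fun i v hi => queryVal_mono h (queryList_getElem? g l₁ _ i v hi)
  have hlen : (queryList g l₁ l₁.length).length ≤ (queryList g l₂ l₂.length).length := by
    refine le_length_queryList ((length_queryList_le _ _ _).trans h.length_le) fun i hi => ?_
    rw [hval i _ (List.getElem?_eq_getElem hi)]
    rfl
  rw [List.prefix_iff_getElem]
  refine ⟨hlen, fun i hi => ?_⟩
  have h₁ := hval i _ (List.getElem?_eq_getElem hi)
  have h₂ := queryList_getElem? g l₂ _ i _ (List.getElem?_eq_getElem (hi.trans_le hlen))
  exact Option.some.inj (h₁.symm.trans h₂)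

theorem computable_queryList {g : ℕ → Option ℕ} (hg : Computable g) :
    Computable fun l : List ℕ => queryList g l l.length := by
  have hval : Computable₂ (queryVal g) := by
    have : Computable fun p : List ℕ × ℕ =>
        (Option.casesOn (g p.2) (some 0) fun i => p.1[i]? : Option ℕ) :=
      Computable.option_casesOn (hg.comp Computable.snd) (Computable.const _)
        (Computable.list_getElem?.comp (Computable.fst.comp Computable.fst) Computable.snd)
    refine this.of_eq fun p => ?_
    unfold queryVal
    cases g p.2 <;> rfl
  have hstep : Computable₂ fun (l : List ℕ) (q : ℕ × List ℕ) =>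
      (Option.casesOn (queryVal g l q.2.length) q.2 fun v => q.2 ++ [v] : List ℕ) :=
    Computable.option_casesOn
      (hval.comp Computable.fst
        (Computable.list_length.comp (Computable.snd.comp Computable.snd)))
      (Computable.snd.comp Computable.snd)
      (Computable.list_concat.comp
        (Computable.snd.comp (Computable.snd.comp Computable.fst)) Computable.snd)
  refine (Computable.nat_rec Computable.list_length (Computable.const []) hstep).of_eq
    fun l => ?_
  generalize l.length = m
  induction m with
  | zero => rfl
  | succ m ih =>
    simp only [queryList]
    rw [← ih]
    cases queryVal g l _ <;> rfl

/-- A computable reindexing of the oracle is a Medvedev reduction. -/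
theorem BaireLE.of_query {P Q : Set (ℕ → ℕ)} {g : ℕ → Option ℕ} (hg : Computable g)
    (h : ∀ x ∈ Q, (fun n => (g n).elim 0 x) ∈ P) : BaireLE P Q := by
  refine ⟨fun l => queryList g l l.length, computable_queryList hg,
    fun _ _ => queryList_prefix, fun x hx => ⟨_, h x hx, fun n => ?_⟩⟩
  set b : ℕ := (Finset.range (n + 1)).sup fun i => (g i).elim 0 id
  have hb : ∀ i ≤ n, ∀ j, g i = some j → j ≤ b := fun i hi j hj => by
    have := Finset.le_sup (f := fun i => (g i).elim 0 id)
      (Finset.mem_range.2 (Nat.lt_succ_of_le hi))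
    simpa [hj] using this
  have hval : ∀ i ≤ n, queryVal g (pref x (n + b + 1)) i = some ((g i).elim 0 x) := by
    intro i hi
    unfold queryVal
    cases hj : g i with
    | none => rfl
    | some j =>
      have := hb i hi j hj
      have hlt : j < n + b + 1 := by omega
      simp [pref, hlt]
  have hlen : n + 1 ≤ (queryList g (pref x (n + b + 1)) (pref x (n + b + 1)).length).length :=
    le_length_queryList (by simp [pref, add_assoc]) fun i hi => by
      rw [hval i (by omega)]
      rfl
  refine ⟨n + b + 1, ?_⟩
  have h₁ := List.getElem?_eq_getElem (Nat.lt_of_succ_le hlen)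
  rw [h₁]
  exact (queryList_getElem? _ _ _ _ _ h₁).symm.trans (hval n le_rfl)

theorem confFun_comp_cover {G A : Type*} [Group G] [Encodable A] {k : ℕ} (σ : Fin k → G)
    (x : G → A) (n : ℕ) :
    confFun (x ∘ cover σ) n = Encodable.encode
      ((Encodable.decode (α := List (Fin k × Bool)) n).map fun w => x (wordVal σ w)) := by
  have : (Encodable.decode n : Option (FreeGroup (Fin k))) =
      (Encodable.decode (α := List (Fin k × Bool)) n).bind fun w => some (FreeGroup.mk w) := rfl
  rw [confFun, this]
  cases (Encodable.decode n : Option (List (Fin k × Bool))) <;> rfl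

/-- A computable translation of words reduces one pulled-back set of configurations to another,
when values of the first at `w` are values of the second at the translation of `w`. -/
theorem MedLE.of_translation {G K A : Type*} [Group G] [Group K] [Encodable A] {k l : ℕ}
    {σ : Fin k → G} {τ : Fin l → K} {X : Set (G → A)} {Y : Set (K → A)}
    {V : List (Fin k × Bool) → List (Fin l × Bool)} (hV : Computable V)
    (h : ∀ y ∈ Y, ∃ x ∈ X, ∀ w, x (wordVal σ w) = y (wordVal τ (V w))) :
    MedLE (pullback (cover σ) X) (pullback (cover τ) Y) := by
  refine BaireLE.of_query (g := fun n =>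
    (Encodable.decode (α := List (Fin k × Bool)) n).map fun w => Encodable.encode (V w))
    (Computable.option_map Computable.decode
      (Computable.encode.comp (hV.comp Computable.snd))) ?_
  rintro _ ⟨_, ⟨y, hy, rfl⟩, rfl⟩
  obtain ⟨x, hx, hxy⟩ := h y hy
  refine ⟨_, ⟨x, hx, rfl⟩, funext fun n => ?_⟩
  rw [confFun_comp_cover]
  cases (Encodable.decode n : Option (List (Fin k × Bool))) with
  | none => rfl
  | some w => simp [confFun_comp_cover, hxy]

end Reductions

section Words

variable {G : Type*} [Group G] {k : ℕ}

theorem wordVal_nil (σ : Fin k → G) : wordVal σ [] = 1 :=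
  map_one (cover σ)

theorem wordVal_append (σ : Fin k → G) (u v : List (Fin k × Bool)) :
    wordVal σ (u ++ v) = wordVal σ u * wordVal σ v := by
  rw [wordVal, ← FreeGroup.mul_mk, map_mul]
  rfl

theorem wordVal_invRev (σ : Fin k → G) (u : List (Fin k × Bool)) :
    wordVal σ (FreeGroup.invRev u) = (wordVal σ u)⁻¹ := by
  rw [wordVal, ← FreeGroup.inv_mk, map_inv]
  rfl

theorem exists_wordVal_eq {σ : Fin k → G} (hσ : IsSymmGen σ) (g : G) :
    ∃ w, wordVal σ w = g := by
  have : (cover σ).range = ⊤ := by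
    rw [cover, FreeGroup.range_lift_eq_closure, hσ.1]
  obtain ⟨a, rfl⟩ := MonoidHom.range_eq_top.1 this g
  exact ⟨a.toWord, by rw [wordVal, FreeGroup.mk_toWord]⟩

theorem wordVal_flatMap {K : Type*} [Group K] {l : ℕ} {σ : Fin k → G} {τ : Fin l → K}
    (ι : K →* G) {U : Fin l × Bool → List (Fin k × Bool)}
    (hU : ∀ s, wordVal σ (U s) = ι (wordVal τ [s])) (w : List (Fin l × Bool)) :
    wordVal σ (w.flatMap U) = ι (wordVal τ w) := by
  induction w with
  | nil => simp [wordVal_nil]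
  | cons s w ih =>
    rw [List.flatMap_cons, wordVal_append, ih, hU, ← map_mul, ← wordVal_append]
    rfl

theorem computable_flatMap {l : ℕ} (U : Fin l × Bool → List (Fin k × Bool)) :
    Computable fun w : List (Fin l × Bool) => w.flatMap U :=
  (Primrec.list_flatMap Primrec.id ((Primrec.dom_finite U).comp₂ Primrec₂.right)).to_comp

theorem computable_invRev :
    Computable (FreeGroup.invRev : List (Fin k × Bool) → List (Fin k × Bool)) := by
  have : Primrec fun w : List (Fin k × Bool) => (w.map fun s => (s.1, !s.2)).reverse :=
    Primrec.list_reverse.comp (Primrec.list_map Primrec.id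
      ((Primrec.dom_finite fun s : Fin k × Bool => (s.1, !s.2)).comp₂ Primrec₂.right))
  exact this.to_comp

end Words

/-- Unbounded search for a decidable property that always succeeds is computable. -/
theorem computable_natFind {α : Type*} [Primcodable α] {p : α → ℕ → Bool}
    (hp : Computable₂ p) (h : ∀ a, ∃ n, p a n = true) :
    Computable fun a => Nat.find (h a) := by
  refine (Partrec.rfind hp.partrec₂).of_eq fun a => ?_
  refine Part.eq_some_iff.2 (Nat.mem_rfind.2 ⟨?_, fun {m} hm => ?_⟩)
  · exact Part.mem_some_iff.2 (Nat.find_spec (h a)).symm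
  · exact Part.mem_some_iff.2 (Bool.eq_false_iff.2 (Nat.find_min (h a) hm)).symm

section FreeExtension

variable {G : Type*} [Group G] {A : Type*} {H : Subgroup G} {k l : ℕ}
  {σ : Fin k → G} {τ : Fin l → ↥H} {X : Set (↥H → A)}

theorem exists_letter_words (hσ : IsSymmGen σ) (τ : Fin l → ↥H) :
    ∃ U : Fin l × Bool → List (Fin k × Bool),
      ∀ w, wordVal σ (w.flatMap U) = ((wordVal τ w : ↥H) : G) := by
  choose U hU using fun s : Fin l × Bool => exists_wordVal_eq hσ ((wordVal τ [s] : ↥H) : G)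
  exact ⟨U, wordVal_flatMap H.subtype hU⟩

theorem medLE_freeExt [Encodable A] (hσ : IsSymmGen σ) :
    MedLE (pullback (cover τ) X) (pullback (cover σ) (freeExt H X)) := by
  obtain ⟨U, hU⟩ := exists_letter_words hσ τ
  refine MedLE.of_translation (computable_flatMap U) fun y hy =>
    ⟨fun h => y h, by simpa using hy 1, fun w => by rw [hU]⟩

/-- If a computable translation of words realizes the map `g ↦ (T g)⁻¹ * g` for a choice `T` of
left coset representatives, then the free extension reduces to the original subshift. -/
theorem freeExt_medLE_of_transversal [Encodable A]
    (hX : ∀ x ∈ X, ∀ g : ↥H, shift g x ∈ X) {T : G → G}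
    (hT : ∀ (g : G) (h : ↥H), T (g * h) = T g) (hmem : ∀ g, (T g)⁻¹ * g ∈ H)
    {V : List (Fin k × Bool) → List (Fin l × Bool)} (hV : Computable V)
    (hVT : ∀ w, ((wordVal τ (V w) : ↥H) : G) = (T (wordVal σ w))⁻¹ * wordVal σ w) :
    MedLE (pullback (cover σ) (freeExt H X)) (pullback (cover τ) X) := by
  refine MedLE.of_translation hV fun x hx =>
    ⟨fun g => x ⟨(T g)⁻¹ * g, hmem g⟩, fun g => ?_, fun w => ?_⟩
  · convert hX x hx ⟨(T g)⁻¹ * g, hmem g⟩⁻¹ using 1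
    funext h
    simp only [shift, inv_inv]
    congr 1
    ext
    simp [hT, mul_assoc]
  · exact congrArg x (Subtype.ext (hVT w).symm)

theorem freeExt_medLE_of_finiteIndex [Encodable A] [H.FiniteIndex] (hτ : IsSymmGen τ)
    (hX : ∀ x ∈ X, ∀ g : ↥H, shift g x ∈ X) :
    MedLE (pullback (cover σ) (freeExt H X)) (pullback (cover τ) X) := by
  obtain ⟨m, ⟨e⟩⟩ := Finite.exists_equiv_fin (G ⧸ H)
  let T : G → G := fun g => (g : G ⧸ H).out
  have hmem : ∀ g, (T g)⁻¹ * g ∈ H := fun g =>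
    QuotientGroup.eq.1 (QuotientGroup.out_eq' (g : G ⧸ H))
  have hT : ∀ (g : G) (h : ↥H), T (g * h) = T g := fun g h => by
    simp only [T, QuotientGroup.mk_mul_of_mem g h.2]
  choose c hc using fun g : G => exists_wordVal_eq hτ ⟨(T g)⁻¹ * g, hmem g⟩
  let r : Fin m → G := fun j => (e.symm j).out
  let step : (Fin k × Bool) → Fin m × List (Fin l × Bool) → Fin m × List (Fin l × Bool) :=
    fun s q => (e (wordVal σ [s] * r q.1 : G), c (wordVal σ [s] * r q.1) ++ q.2)
  have hstep : Primrec₂ step := by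
    have h₁ : Primrec fun p : (Fin k × Bool) × Fin m =>
        e (wordVal σ [p.1] * r p.2 : G) := Primrec.dom_finite _
    have h₂ : Primrec fun p : (Fin k × Bool) × Fin m =>
        c (wordVal σ [p.1] * r p.2) := Primrec.dom_finite _
    have hp : Primrec fun p : (Fin k × Bool) × (Fin m × List (Fin l × Bool)) =>
        (p.1, p.2.1) := Primrec.pair Primrec.fst (Primrec.fst.comp Primrec.snd)
    exact Primrec.pair (h₁.comp hp)
      (Primrec.list_append.comp (h₂.comp hp) (Primrec.snd.comp Primrec.snd))
  let run : List (Fin k × Bool) → Fin m × List (Fin l × Bool) :=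
    fun w => w.foldr step (e ((1 : G) : G ⧸ H), c 1)
  have hrun : Primrec run :=
    Primrec.list_foldr Primrec.id (Primrec.const _)
      (hstep.comp₂ (Primrec.fst.comp₂ Primrec₂.right) (Primrec.snd.comp₂ Primrec₂.right))
  have hspec : ∀ w, (run w).1 = e (wordVal σ w : G) ∧
      ((wordVal τ (run w).2 : ↥H) : G) = (T (wordVal σ w))⁻¹ * wordVal σ w := by
    intro w
    induction w with
    | nil => simp [run, wordVal_nil, hc]
    | cons s w ih =>
      obtain ⟨ih₁, ih₂⟩ := ih
      have hcons : wordVal σ (s :: w) = wordVal σ [s] * wordVal σ w := wordVal_append σ [s] w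
      have hr : r (run w).1 = T (wordVal σ w) := by simp [r, T, ih₁]
      have hrun_cons : run (s :: w) = step s (run w) := rfl
      have hw : wordVal σ [s] * wordVal σ w =
          wordVal σ [s] * T (wordVal σ w) *
            ((⟨_, hmem (wordVal σ w)⟩ : ↥H) : G) := by
        simp [mul_assoc]
      have hTw : T (wordVal σ [s] * wordVal σ w) = T (wordVal σ [s] * T (wordVal σ w)) := by
        rw [hw, hT]
      rw [hrun_cons, hcons]
      simp only [step, hr]
      refine ⟨?_, ?_⟩
      · rw [hw, QuotientGroup.mk_mul_of_mem _ (Subtype.prop _)]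
      · rw [wordVal_append, Subgroup.coe_mul, ih₂, hc, hTw]
        simp [mul_assoc]
  exact freeExt_medLE_of_transversal hX hT hmem (Computable.snd.comp hrun.to_comp)
    fun w => (hspec w).2

theorem freeExt_medLE_of_decidableMembership [Encodable A] (hσ : IsSymmGen σ)
    (hτ : IsSymmGen τ) (hG : RecursivelyPresented σ) (hH : DecidableMembership σ H)
    (hX : ∀ x ∈ X, ∀ g : ↥H, shift g x ∈ X) :
    MedLE (pullback (cover σ) (freeExt H X)) (pullback (cover τ) X) := by
  obtain ⟨f, hf, hf'⟩ := hG
  obtain ⟨φ, hφ, hφ'⟩ := hH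
  obtain ⟨U, hU⟩ := exists_letter_words hσ τ
  let word : (j : ℕ) → ℕ → List (Fin j × Bool) := fun j n => (Encodable.decode n).getD []
  have hword : ∀ j, Computable (word j) := fun j =>
    Computable.option_getD Computable.decode (Computable.const [])
  have hword_encode : ∀ j w, word j (Encodable.encode w) = w := fun j w => by simp [word]
  have happend : Computable₂ fun u v : List (Fin k × Bool) => u ++ v :=
    Primrec.list_append.to_comp
  have hrep : ∀ g : G, ∃ n, (wordVal σ (word k n))⁻¹ * g ∈ H := fun g => by
    obtain ⟨w, rfl⟩ := exists_wordVal_eq hσ g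
    exact ⟨Encodable.encode w, by simp [hword_encode]⟩
  classical
  let T : G → G := fun g => wordVal σ (word k (Nat.find (hrep g)))
  have hmem : ∀ g, (T g)⁻¹ * g ∈ H := fun g => Nat.find_spec (hrep g)
  have hT : ∀ (g : G) (h : ↥H), T (g * h) = T g := fun g h => by
    have : Nat.find (hrep (g * h)) = Nat.find (hrep g) := by
      refine Nat.find_congr' fun {n} => ?_
      rw [← mul_assoc]
      exact H.mul_mem_cancel_right h.2
    simp only [T, this]
  let p : List (Fin k × Bool) → ℕ → Bool := fun w n => φ (FreeGroup.invRev (word k n) ++ w)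
  have hp : Computable₂ p :=
    hφ.comp (happend.comp (computable_invRev.comp ((hword k).comp Computable.snd))
      Computable.fst)
  have hp_iff : ∀ w n, p w n = true ↔ (wordVal σ (word k n))⁻¹ * wordVal σ w ∈ H :=
    fun w n => by rw [hφ', wordVal_append, wordVal_invRev]
  have hp_ex : ∀ w, ∃ n, p w n = true := fun w =>
    (hrep (wordVal σ w)).imp fun n hn => (hp_iff w n).2 hn
  let R : List (Fin k × Bool) → List (Fin k × Bool) := fun w =>
    FreeGroup.invRev (word k (Nat.find (hp_ex w))) ++ w
  have hR : Computable R :=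
    happend.comp (computable_invRev.comp ((hword k).comp (computable_natFind hp hp_ex)))
      Computable.id
  have hR_val : ∀ w, wordVal σ (R w) = (T (wordVal σ w))⁻¹ * wordVal σ w := fun w => by
    have : Nat.find (hp_ex w) = Nat.find (hrep (wordVal σ w)) :=
      Nat.find_congr' fun {n} => hp_iff w n
    simp only [R, T, wordVal_append, wordVal_invRev, this]
  let q : List (Fin k × Bool) → ℕ → Bool := fun w n => decide
    (f n.unpair.1 = some (FreeGroup.invRev ((word l n.unpair.2).flatMap U) ++ R w))
  have hq : Computable₂ q := by
    have heq : Computable₂ fun a b : Option (List (Fin k × Bool)) => decide (a = b) :=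
      Primrec.eq.decide.to_comp
    have hun : Computable Nat.unpair := Primrec.unpair.to_comp
    exact heq.comp (hf.comp (Computable.fst.comp (hun.comp Computable.snd)))
      (Computable.option_some.comp (happend.comp
        (computable_invRev.comp ((computable_flatMap U).comp
          ((hword l).comp (Computable.snd.comp (hun.comp Computable.snd)))))
        (hR.comp Computable.fst)))
  have hq_ex : ∀ w, ∃ n, q w n = true := fun w => by
    obtain ⟨v, hv⟩ := exists_wordVal_eq hτ ⟨_, hmem (wordVal σ w)⟩
    have h1 : wordVal σ (FreeGroup.invRev (v.flatMap U) ++ R w) = 1 := by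
      rw [wordVal_append, wordVal_invRev, hU, hv, hR_val]
      exact inv_mul_cancel _
    obtain ⟨n, hn⟩ := (hf' _).1 h1
    exact ⟨Nat.pair n (Encodable.encode v), by simp [q, hword_encode, hn]⟩
  refine freeExt_medLE_of_transversal hX hT hmem
    (V := fun w => word l (Nat.find (hq_ex w)).unpair.2)
    ((hword l).comp (Computable.snd.comp
      (Primrec.unpair.to_comp.comp (computable_natFind hq hq_ex)))) fun w => ?_
  have h1 := (hf' _).2 ⟨_, of_decide_eq_true (Nat.find_spec (hq_ex w))⟩
  rw [wordVal_append, wordVal_invRev, hU, hR_val, inv_mul_eq_one] at h1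
  exact h1

end FreeExtension

/-- For `H ≤ G` finitely generated and `X ⊆ A^H` a subshift, `m(X) ≤ m(X̃)` for the free
extension `X̃` of `X` to `G`; moreover if (1) `G` is recursively presented and `H` has
decidable membership problem in `G`, or (2) `H` has finite index in `G`, then
`m(X) = m(X̃)`. -/
theorem statement2 {G : Type*} [Group G] {A : Type*} [Finite A] [Encodable A]
    (H : Subgroup G) {k l : ℕ} (σ : Fin k → G) (hσ : IsSymmGen σ)
    (τ : Fin l → ↥H) (hτ : IsSymmGen τ)
    (X : Set (↥H → A)) (hX : IsSubshift X) :
    MedLE (pullback (cover τ) X) (pullback (cover σ) (freeExt H X)) ∧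
    (((RecursivelyPresented σ ∧ DecidableMembership σ H) ∨ H.FiniteIndex) →
      MedEquiv (pullback (cover τ) X) (pullback (cover σ) (freeExt H X))) := by
  have hle := medLE_freeExt (X := X) (τ := τ) hσ
  refine ⟨hle, fun h => ⟨hle, ?_⟩⟩
  rcases h with ⟨hG, hH⟩ | hfin
  · exact freeExt_medLE_of_decidableMembership hσ hτ hG hH hX.1
  · exact freeExt_medLE_of_finiteIndex hτ hX.1

end MedvedevFormal
end
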